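/- arXiv:2010.09597 — 2 statements merged into one kernel-verified Lean document; each statement's English description precedes it below -/
import Mathlib

section
/- Assume each ∇f_i is L-Lipschitz with G = max_{i∈[n]} ‖∇f_i(0)‖₂, let R > 0, β > 0, η > 0, B ≤ n, and set M = LR + G. For u, w ∈ ℝ^d with ‖u‖₂ ≤ R and ‖w‖₂ ≤ R, define I₁ = E_I[ exp( −βf(w) − β‖u − w + η g(w,I)‖₂²/(4η) ) ] and I₂ = E_I[ exp( −βf(u) − β‖w − u + η g(u,I)‖₂²/(4η) ) ], where I is a uniformly random size-B subset of {1,…,n}. Then I₁/I₂ ≥ exp( −Lβ‖w−u‖₂²/2 − βηL(LR+G)‖w−u‖₂/2 − β²M²(‖w−u‖₂² + (LR+G)²η² + ηd/(2β))/(2B) ). -/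
open MeasureTheory
open scoped InnerProductSpace BigOperators

/-- The mini-batch stochastic gradient `g(x, I) = (1/B) ∑_{i ∈ I} ∇f_i(x)`. -/
noncomputable def stochGrad {d n : ℕ} (fi : Fin n → EuclideanSpace ℝ (Fin d) → ℝ) (B : ℕ)
    (x : EuclideanSpace ℝ (Fin d)) (I : Finset (Fin n)) : EuclideanSpace ℝ (Fin d) :=
  (B : ℝ)⁻¹ • ∑ i ∈ I, gradient (fi i) x

/-- Expectation of `X` over a uniformly random size-`B` subset `I` of `{1,…,n}`. -/
noncomputable def expectSubsets (n B : ℕ) (X : Finset (Fin n) → ℝ) : ℝ :=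
  (∑ I ∈ Finset.univ.filter (fun I : Finset (Fin n) => I.card = B), X I) /
    ((Finset.univ.filter (fun I : Finset (Fin n) => I.card = B)).card : ℝ)

/-- The graph of `x ↦ x ^ (k + 1)` lies above its tangent at `m` on the nonnegative reals. -/
theorem pow_succ_add_mul_sub_le_pow_succ {m A : ℝ} (hm : 0 ≤ m) (hA : 0 ≤ A) (k : ℕ) :
    m ^ (k + 1) + (k + 1) * m ^ k * (A - m) ≤ A ^ (k + 1) := by
  rcases hm.eq_or_lt with rfl | hpos
  · rcases Nat.eq_zero_or_pos k with rfl | hk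
    · simp
    · simpa [hk.ne'] using pow_nonneg hA (k + 1)
  · have h1 : -1 ≤ A / m := by linarith [div_nonneg hA hpos.le]
    have h2 := mul_le_mul_of_nonneg_left (one_add_mul_sub_le_pow h1 (k + 1))
      (pow_pos hpos (k + 1)).le
    rw [← mul_pow, mul_div_cancel₀ _ hpos.ne'] at h2
    refine le_trans (le_of_eq ?_) h2
    push_cast
    field_simp
    ring

open Finset in
/-- The weak Maclaurin inequality `e_k / C(n, k) ≤ (e_1 / n) ^ k` for nonnegative reals. -/
theorem sum_powersetCard_prod_le {ι : Type*} [DecidableEq ι] (x : ι → ℝ) (hx : ∀ i, 0 ≤ x i)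
    (s : Finset ι) (k : ℕ) :
    ∑ I ∈ s.powersetCard k, ∏ i ∈ I, x i ≤ (#s).choose k * ((∑ i ∈ s, x i) / #s) ^ k := by
  induction s using Finset.induction_on generalizing k with
  | empty => cases k <;> simp [powersetCard_eq_empty.mpr (card_empty.trans_lt (Nat.succ_pos _))]
  | insert a s ha ih =>
    cases k with
    | zero => simp
    | succ k =>
      have hinj : Set.InjOn (insert a) ((s.powersetCard k : Finset (Finset ι)) : Set (Finset ι)) := by
        intro I hI J hJ h
        have hI' : a ∉ I := fun h' => ha ((mem_powersetCard.mp hI).1 h')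
        have hJ' : a ∉ J := fun h' => ha ((mem_powersetCard.mp hJ).1 h')
        rw [← erase_insert hI', h, erase_insert hJ']
      have hdisj : Disjoint (s.powersetCard (k + 1)) ((s.powersetCard k).image (insert a)) := by
        rw [disjoint_left]
        intro I hI hI'
        obtain ⟨J, -, rfl⟩ := mem_image.mp hI'
        exact ha ((mem_powersetCard.mp hI).1 (mem_insert_self a J))
      have hprod : ∀ I ∈ s.powersetCard k, ∏ i ∈ insert a I, x i = x a * ∏ i ∈ I, x i :=
        fun I hI => prod_insert fun h' => ha ((mem_powersetCard.mp hI).1 h')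
      rw [powersetCard_succ_insert ha, sum_union hdisj, sum_image hinj, sum_congr rfl hprod,
        ← mul_sum, card_insert_of_notMem ha, sum_insert ha]
      set m := (∑ i ∈ s, x i) / #s with hm
      have hm0 : 0 ≤ m := div_nonneg (sum_nonneg fun i _ => hx i) (Nat.cast_nonneg _)
      have hsm : ∑ i ∈ s, x i = #s * m := by
        rcases s.eq_empty_or_nonempty with rfl | hs
        · simp
        · rw [hm, mul_div_cancel₀ _ (by simpa using hs.ne_empty)]
      clear_value m
      generalize #s = N at ih hm hsm ⊢
      have hn : (0 : ℝ) < N + 1 := by positivity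
      have hA : (x a + ∑ i ∈ s, x i) / ((N + 1 : ℕ) : ℝ) = m + (x a - m) / (N + 1) := by
        rw [hsm]; push_cast; field_simp; ring
      have hA0 : 0 ≤ m + (x a - m) / (N + 1) := by
        rw [← hA, hsm]; have := hx a; positivity
      have hbern : m ^ (k + 1) + (k + 1) * m ^ k * ((x a - m) / (N + 1))
          ≤ (m + (x a - m) / (N + 1)) ^ (k + 1) := by
        simpa using pow_succ_add_mul_sub_le_pow_succ hm0 hA0 k
      have hch : ((N + 1).choose (k + 1) : ℝ) = N.choose k + N.choose (k + 1) := by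
        exact_mod_cast Nat.choose_succ_succ N k
      have hch2 : ((N : ℝ) + 1) * N.choose k = (N + 1).choose (k + 1) * (k + 1) := by
        exact_mod_cast Nat.add_one_mul_choose_eq N k
      rw [hA]
      calc _ ≤ N.choose (k + 1) * m ^ (k + 1) + x a * (N.choose k * m ^ k) :=
            add_le_add (ih _) (mul_le_mul_of_nonneg_left (ih _) (hx a))
        _ = ((N + 1).choose (k + 1) : ℝ) *
            (m ^ (k + 1) + (k + 1) * m ^ k * ((x a - m) / (N + 1))) := by
          have : ((N + 1).choose (k + 1) : ℝ) * ((k + 1) * m ^ k * ((x a - m) / (N + 1)))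
              = N.choose k * m ^ k * (x a - m) := by
            rw [show ((N + 1).choose (k + 1) : ℝ) * ((k + 1) * m ^ k * ((x a - m) / (N + 1)))
              = ((N + 1).choose (k + 1) * (k + 1)) * (m ^ k * ((x a - m) / (N + 1))) by ring,
              ← hch2]
            field_simp
          rw [mul_add, this, hch]
          ring
        _ ≤ _ := mul_le_mul_of_nonneg_left hbern (Nat.cast_nonneg _)

theorem expectSubsets_eq (n B : ℕ) (X : Finset (Fin n) → ℝ) :
    expectSubsets n B X =
      (∑ I ∈ Finset.powersetCard B Finset.univ, X I) / (n.choose B : ℝ) := by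
  have h : Finset.univ.filter (fun I : Finset (Fin n) => I.card = B) =
      Finset.powersetCard B Finset.univ := by
    ext; simp [Finset.mem_powersetCard]
  rw [expectSubsets, h, Finset.card_powersetCard, Finset.card_univ, Fintype.card_fin]

theorem expectSubsets_add (n B : ℕ) (X Y : Finset (Fin n) → ℝ) :
    expectSubsets n B (fun I => X I + Y I) = expectSubsets n B X + expectSubsets n B Y := by
  simp only [expectSubsets, Finset.sum_add_distrib, add_div]

theorem expectSubsets_const_mul (n B : ℕ) (c : ℝ) (X : Finset (Fin n) → ℝ) :
    expectSubsets n B (fun I => c * X I) = c * expectSubsets n B X := by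
  simp only [expectSubsets, ← Finset.mul_sum, mul_div_assoc]

theorem expectSubsets_const {n B : ℕ} (hBn : B ≤ n) (c : ℝ) :
    expectSubsets n B (fun _ => c) = c := by
  have : (n.choose B : ℝ) ≠ 0 := by exact_mod_cast (Nat.choose_pos hBn).ne'
  rw [expectSubsets_eq]
  simp [this]

theorem expectSubsets_mono (n B : ℕ) {X Y : Finset (Fin n) → ℝ} (h : ∀ I, X I ≤ Y I) :
    expectSubsets n B X ≤ expectSubsets n B Y :=
  div_le_div_of_nonneg_right (Finset.sum_le_sum fun I _ => h I) (Nat.cast_nonneg _)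

theorem exp_expectSubsets_le {n B : ℕ} (hBn : B ≤ n) (X : Finset (Fin n) → ℝ) :
    Real.exp (expectSubsets n B X) ≤ expectSubsets n B (fun I => Real.exp (X I)) := by
  set m := expectSubsets n B X with hm
  have h : ∀ I, Real.exp m * (1 - m) + Real.exp m * X I ≤ Real.exp (X I) := fun I => by
    have h1 := Real.add_one_le_exp (X I - m)
    have h2 : Real.exp (X I) = Real.exp m * Real.exp (X I - m) := by
      rw [← Real.exp_add]; ring_nf
    rw [h2]
    nlinarith [Real.exp_pos m]
  refine le_trans (le_of_eq ?_) (expectSubsets_mono n B h)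
  rw [expectSubsets_add, expectSubsets_const hBn, expectSubsets_const_mul, ← hm]
  ring

/-- The inclusion probability of one index in a uniform size-`B` subset is `B / n`. -/
theorem expectSubsets_sum {n B : ℕ} (hB1 : 1 ≤ B) (hBn : B ≤ n) (a : Fin n → ℝ) :
    expectSubsets n B (fun I => ∑ i ∈ I, a i) = B / n * ∑ i, a i := by
  rw [expectSubsets_eq, Finset.sum_comm' (t' := Finset.univ)
    (s' := fun i => (Finset.powersetCard B Finset.univ).filter ({i} ⊆ ·)) (by simp)]
  have hcard (i : Fin n) := Finset.card_filter_powersetCard_subset {i} Finset.univ B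
    (Finset.subset_univ _) (by simpa using hB1)
  simp only [Finset.card_singleton, Finset.card_univ, Fintype.card_fin] at hcard
  simp only [Finset.sum_const, hcard, nsmul_eq_mul, ← Finset.mul_sum]
  obtain ⟨b, rfl⟩ := Nat.exists_eq_add_of_le' hB1
  obtain ⟨N, rfl⟩ := Nat.exists_eq_add_of_le' (hB1.trans hBn)
  have h : ((N : ℝ) + 1) * N.choose b = (N + 1).choose (b + 1) * (b + 1) := by
    exact_mod_cast Nat.add_one_mul_choose_eq N b
  have h0 : ((N + 1).choose (b + 1) : ℝ) ≠ 0 := by exact_mod_cast (Nat.choose_pos hBn).ne'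
  have h1 : ((N : ℝ) + 1) ≠ 0 := by positivity
  simp only [Nat.add_sub_cancel]
  push_cast
  field_simp
  linear_combination (∑ i, a i) * h

/-- Sampling without replacement does not increase the second moment of a centred sum. -/
theorem expectSubsets_norm_sum_sq_le {E : Type*} [NormedAddCommGroup E] [InnerProductSpace ℝ E]
    {n B : ℕ} (hB1 : 1 ≤ B) (hBn : B ≤ n) (y : Fin n → E) (hy : ∑ i, y i = 0) :
    expectSubsets n B (fun I => ‖∑ i ∈ I, y i‖ ^ 2) ≤ B / n * ∑ i, ‖y i‖ ^ 2 := by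
  obtain ⟨c, hc⟩ : ∃ c : ℕ, ∀ i j : Fin n, i ≠ j →
      ((Finset.powersetCard B Finset.univ).filter ({i, j} ⊆ ·)).card = c := by
    by_cases hB : 2 ≤ B
    · refine ⟨(n - 2).choose (B - 2), fun i j hij => ?_⟩
      have := Finset.card_filter_powersetCard_subset {i, j} Finset.univ B
        (Finset.subset_univ _) (by rwa [Finset.card_pair hij])
      simpa [Finset.card_pair hij] using this
    · refine ⟨0, fun i j hij => ?_⟩
      rw [Finset.card_eq_zero, Finset.filter_eq_empty_iff]
      intro I hI hsub
      have := Finset.card_le_card hsub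
      rw [Finset.card_pair hij, (Finset.mem_powersetCard.mp hI).2] at this
      exact hB this
  have hoff : ∑ I ∈ Finset.powersetCard B Finset.univ,
      (‖∑ i ∈ I, y i‖ ^ 2 - ∑ i ∈ I, ‖y i‖ ^ 2) = -(c * ∑ i, ‖y i‖ ^ 2) := by
    have hexp (I : Finset (Fin n)) : ‖∑ i ∈ I, y i‖ ^ 2 - ∑ i ∈ I, ‖y i‖ ^ 2 =
        ∑ p ∈ (I ×ˢ I).filter (fun p => p.1 ≠ p.2), ⟪y p.1, y p.2⟫_ℝ := by
      rw [← real_inner_self_eq_norm_sq, sum_inner, sub_eq_iff_eq_add]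
      simp_rw [inner_sum]
      rw [← Finset.sum_product', ← Finset.sum_filter_not_add_sum_filter (I ×ˢ I)
        (fun p => p.1 = p.2)]
      congr 1
      rw [← Finset.diag_eq_filter, Finset.sum_diag]
      simp
    have huniv := hexp Finset.univ
    rw [hy] at huniv
    simp_rw [hexp]
    rw [Finset.sum_comm' (t' := (Finset.univ ×ˢ Finset.univ).filter (fun p => p.1 ≠ p.2))
      (s' := fun p => (Finset.powersetCard B Finset.univ).filter ({p.1, p.2} ⊆ ·))
      (by simp [Finset.insert_subset_iff]; tauto)]
    rw [Finset.sum_congr rfl (g := fun p => (c : ℝ) * ⟪y p.1, y p.2⟫_ℝ) fun p hp => by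
      rw [Finset.sum_const, hc _ _ (Finset.mem_filter.mp hp).2, nsmul_eq_mul]]
    rw [← Finset.mul_sum, ← huniv]
    simp
  rw [← expectSubsets_sum hB1 hBn, expectSubsets_eq, expectSubsets_eq]
  refine div_le_div_of_nonneg_right ?_ (Nat.cast_nonneg _)
  rw [Finset.sum_sub_distrib] at hoff
  have : 0 ≤ (c : ℝ) * ∑ i, ‖y i‖ ^ 2 := by positivity
  linarith

theorem expectSubsets_exp_sum_le (n B : ℕ) (a : Fin n → ℝ) (hBn : B ≤ n) :
    expectSubsets n B (fun I => Real.exp (∑ i ∈ I, a i)) ≤ ((∑ i, Real.exp (a i)) / n) ^ B := by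
  have h0 : (0 : ℝ) < n.choose B := by exact_mod_cast Nat.choose_pos hBn
  rw [expectSubsets_eq, div_le_iff₀' h0]
  simpa [Real.exp_sum] using sum_powersetCard_prod_le (fun i => Real.exp (a i))
    (fun i => (Real.exp_pos _).le) Finset.univ B

/-- Hoeffding's lemma for the uniform distribution on `Fin n`. -/
theorem mean_exp_le {n : ℕ} (hn : 0 < n) (a : Fin n → ℝ) {K : ℝ} (ha : ∀ i, |a i| ≤ K) :
    (∑ i, Real.exp (a i)) / n ≤ Real.exp ((∑ i, a i) / n + K ^ 2 / 2) := by
  have : Nonempty (Fin n) := ⟨⟨0, hn⟩⟩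
  have hK : 0 ≤ K := (abs_nonneg _).trans (ha ⟨0, hn⟩)
  set μ := (PMF.uniformOfFintype (Fin n)).toMeasure
  have hint (X : Fin n → ℝ) : ∫ i, X i ∂μ = (∑ i, X i) / n := by
    rw [PMF.integral_eq_sum]
    simp [← Finset.mul_sum, div_eq_inv_mul]
  have h := (ProbabilityTheory.hasSubgaussianMGF_of_mem_Icc (μ := μ) (X := a) (a := -K) (b := K)
    (measurable_of_finite a).aemeasurable
    (Filter.Eventually.of_forall fun i => abs_le.mp (ha i))).mgf_le 1
  rw [ProbabilityTheory.mgf, hint, hint] at h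
  have hc : (((‖K - -K‖₊ / 2) ^ 2 : NNReal) : ℝ) * 1 ^ 2 / 2 = K ^ 2 / 2 := by
    push_cast
    rw [Real.norm_eq_abs, abs_of_nonneg (by linarith)]
    ring
  rw [hc] at h
  simp only [one_mul, Real.exp_sub, ← Finset.sum_div] at h
  rw [Real.exp_add]
  rw [div_right_comm, div_le_iff₀ (Real.exp_pos _)] at h
  linarith

/-- The descent lemma. -/
theorem le_add_inner_gradient_of_lipschitz {E : Type*} [NormedAddCommGroup E]
    [InnerProductSpace ℝ E] [CompleteSpace E] {φ : E → ℝ} {g : E → E} {L : ℝ}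
    (hφ : ∀ x, HasGradientAt φ (g x) x)
    (hL : ∀ x y, ‖g x - g y‖ ≤ L * ‖x - y‖) (x v : E) :
    φ (x + v) ≤ φ x + ⟪g x, v⟫_ℝ + L / 2 * ‖v‖ ^ 2 := by
  set ψ : ℝ → ℝ := fun t =>
    φ (x + t • v) - t * ⟪g x, v⟫_ℝ - L / 2 * ‖v‖ ^ 2 * t ^ 2 with hψ
  have hd (t : ℝ) : HasDerivAt ψ
      (⟪g (x + t • v), v⟫_ℝ - ⟪g x, v⟫_ℝ - L / 2 * ‖v‖ ^ 2 * (2 * t)) t := by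
    have h1 : HasDerivAt (fun t : ℝ => x + t • v) v t := by
      simpa using ((hasDerivAt_id t).smul_const v).const_add x
    have h2 := (hφ (x + t • v)).hasFDerivAt.comp_hasDerivAt t h1
    have h3 := (h2.sub ((hasDerivAt_id t).mul_const ⟪g x, v⟫_ℝ)).sub
      ((hasDerivAt_pow 2 t).const_mul (L / 2 * ‖v‖ ^ 2))
    exact h3.congr_deriv (by simp)
  have hanti : AntitoneOn ψ (Set.Ici 0) := by
    refine antitoneOn_of_deriv_nonpos (convex_Ici 0)
      (fun t _ => (hd t).continuousAt.continuousWithinAt)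
      (fun t _ => (hd t).differentiableAt.differentiableWithinAt) fun t ht => ?_
    have ht0 : 0 < t := by simpa using ht
    rw [(hd t).deriv, ← inner_sub_left]
    have h1 := real_inner_le_norm (g (x + t • v) - g x) v
    have h2 := hL (x + t • v) x
    rw [add_sub_cancel_left, norm_smul, Real.norm_eq_abs, abs_of_pos ht0] at h2
    nlinarith [mul_le_mul_of_nonneg_right h2 (norm_nonneg v)]
  have h := hanti (Set.mem_Ici.mpr le_rfl) (Set.mem_Ici.mpr zero_le_one) zero_le_one
  simp only [hψ, one_smul, zero_smul, add_zero] at h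
  linarith

/-- Error bound for the trapezoidal rule along a segment. -/
theorem sub_le_inner_gradient_add_of_lipschitz {E : Type*} [NormedAddCommGroup E]
    [InnerProductSpace ℝ E] [CompleteSpace E] {φ : E → ℝ} {g : E → E} {L : ℝ}
    (hφ : ∀ x, HasGradientAt φ (g x) x) (hL : ∀ x y, ‖g x - g y‖ ≤ L * ‖x - y‖) (u w : E) :
    φ w - φ u ≤ ⟪w - u, g w + g u⟫_ℝ / 2 + L / 2 * ‖w - u‖ ^ 2 := by
  have h1 := le_add_inner_gradient_of_lipschitz hφ hL u (w - u)
  have hneg (x : E) : HasGradientAt (fun x => -φ x) (-g x) x := by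
    rw [hasGradientAt_iff_hasFDerivAt, map_neg]
    exact (hφ x).hasFDerivAt.neg
  have h2 := le_add_inner_gradient_of_lipschitz hneg
    (fun x y => by rw [← neg_sub', norm_neg]; exact hL x y) w (u - w)
  rw [add_sub_cancel] at h1 h2
  rw [norm_sub_rev u w, ← neg_sub w u, inner_neg_neg] at h2
  rw [inner_add_right, real_inner_comm, real_inner_comm (g u)]
  linarith

theorem norm_mean_le {E : Type*} [NormedAddCommGroup E] [NormedSpace ℝ E] {n : ℕ} (hn : 0 < n)
    {y : Fin n → E} {M : ℝ} (hy : ∀ i, ‖y i‖ ≤ M) : ‖(n : ℝ)⁻¹ • ∑ i, y i‖ ≤ M := by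
  have hn' : (0 : ℝ) < n := by exact_mod_cast hn
  rw [norm_smul, Real.norm_eq_abs, abs_of_pos (inv_pos.mpr hn'), inv_mul_le_iff₀ hn']
  exact (norm_sum_le_of_le _ fun i _ => hy i).trans (by simp)

/-- Lower bound for the exponential moment of a concave quadratic in a mini-batch mean. -/
theorem exp_le_expectSubsets_exp {E : Type*} [NormedAddCommGroup E] [InnerProductSpace ℝ E]
    {n B : ℕ} (hB1 : 1 ≤ B) (hBn : B ≤ n) {y : Fin n → E} {M : ℝ} (hy : ∀ i, ‖y i‖ ≤ M)
    {m : E} (hm : m = (n : ℝ)⁻¹ • ∑ i, y i) (a : ℝ) (b : E) {c : ℝ} (hc : 0 ≤ c) :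
    Real.exp (a + ⟪b, m⟫_ℝ - c * (‖m‖ ^ 2 + M ^ 2 / B)) ≤
      expectSubsets n B (fun I => Real.exp
        (a + ⟪b, (B : ℝ)⁻¹ • ∑ i ∈ I, y i⟫_ℝ - c * ‖(B : ℝ)⁻¹ • ∑ i ∈ I, y i‖ ^ 2)) := by
  have hn' : (0 : ℝ) < n := by exact_mod_cast hB1.trans hBn
  have hB' : (0 : ℝ) < B := by exact_mod_cast hB1
  have hsum : ∑ i, y i = (n : ℝ) • m := by rw [hm, smul_inv_smul₀ hn'.ne']
  have hcent : ∑ i, (y i - m) = 0 := by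
    simp [Finset.sum_sub_distrib, hsum, ← Nat.cast_smul_eq_nsmul ℝ]
  have hvar : ∑ i, ‖y i - m‖ ^ 2 ≤ n * M ^ 2 := by
    have h1 : ∑ i, ‖y i - m‖ ^ 2 = ∑ i, ‖y i‖ ^ 2 - n * ‖m‖ ^ 2 := by
      simp_rw [norm_sub_sq_real, Finset.sum_add_distrib, Finset.sum_sub_distrib, ← Finset.mul_sum,
        ← sum_inner, hsum, real_inner_smul_left, real_inner_self_eq_norm_sq]
      simp
      ring
    have h2 : ∑ i, ‖y i‖ ^ 2 ≤ ∑ _i : Fin n, M ^ 2 :=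
      Finset.sum_le_sum fun i _ => pow_le_pow_left₀ (norm_nonneg _) (hy i) 2
    rw [Finset.sum_const, Finset.card_univ, Fintype.card_fin, nsmul_eq_mul] at h2
    nlinarith [sq_nonneg ‖m‖]
  have hsecond : expectSubsets n B (fun I => ‖∑ i ∈ I, (y i - m)‖ ^ 2) ≤ B * M ^ 2 := by
    refine (expectSubsets_norm_sum_sq_le hB1 hBn _ hcent).trans ?_
    rw [div_mul_eq_mul_div, div_le_iff₀ hn']
    nlinarith [mul_le_mul_of_nonneg_left hvar hB'.le]
  have hfirst : expectSubsets n B (fun I => ∑ i ∈ I, ⟪b - (2 * c) • m, y i - m⟫_ℝ) = 0 := by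
    rw [expectSubsets_sum hB1 hBn, ← inner_sum, hcent, inner_zero_right, mul_zero]
  -- expand each exponent around the full mean, with fluctuation `(B : ℝ)⁻¹ • ∑ i ∈ I, (y i - m)`
  have key : expectSubsets n B (fun I =>
      ((a + ⟪b, m⟫_ℝ - c * ‖m‖ ^ 2) + (B : ℝ)⁻¹ * ∑ i ∈ I, ⟪b - (2 * c) • m, y i - m⟫_ℝ) +
        (-c * ((B : ℝ)⁻¹) ^ 2) * ‖∑ i ∈ I, (y i - m)‖ ^ 2) ≥
      a + ⟪b, m⟫_ℝ - c * (‖m‖ ^ 2 + M ^ 2 / B) := by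
    rw [expectSubsets_add, expectSubsets_add, expectSubsets_const hBn, expectSubsets_const_mul,
      expectSubsets_const_mul, hfirst]
    have h := mul_le_mul_of_nonneg_left hsecond (mul_nonneg hc (sq_nonneg (B : ℝ)⁻¹))
    have h' : c * ((B : ℝ)⁻¹) ^ 2 * (B * M ^ 2) = c * (M ^ 2 / B) := by field_simp
    rw [h'] at h
    linarith
  refine ((Real.exp_le_exp.mpr key).trans (exp_expectSubsets_le hBn _)).trans (le_of_eq ?_)
  rw [expectSubsets, expectSubsets]
  congr 1
  refine Finset.sum_congr rfl fun I hI => congrArg Real.exp ?_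
  have hcard : I.card = B := (Finset.mem_filter.mp hI).2
  have hg : (B : ℝ)⁻¹ • ∑ i ∈ I, y i = m + (B : ℝ)⁻¹ • ∑ i ∈ I, (y i - m) := by
    rw [Finset.sum_sub_distrib, Finset.sum_const, hcard, ← Nat.cast_smul_eq_nsmul ℝ, smul_sub,
      inv_smul_smul₀ hB'.ne', add_sub_cancel]
  rw [hg, ← inner_sum, norm_add_sq_real, norm_smul, inner_add_right, inner_sub_left,
    real_inner_smul_left, real_inner_smul_right, real_inner_smul_right, mul_pow, norm_inv,
    Real.norm_natCast]
  ring

/-- Upper bound for the exponential moment of a concave quadratic in a mini-batch mean. -/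
theorem expectSubsets_exp_le {E : Type*} [NormedAddCommGroup E] [InnerProductSpace ℝ E]
    {n B : ℕ} (hB1 : 1 ≤ B) (hBn : B ≤ n) {y : Fin n → E} {M : ℝ} (hy : ∀ i, ‖y i‖ ≤ M)
    {m : E} (hm : m = (n : ℝ)⁻¹ • ∑ i, y i) (a : ℝ) (b : E) {c : ℝ} (hc : 0 ≤ c) :
    expectSubsets n B (fun I => Real.exp
        (a - ⟪b, (B : ℝ)⁻¹ • ∑ i ∈ I, y i⟫_ℝ - c * ‖(B : ℝ)⁻¹ • ∑ i ∈ I, y i‖ ^ 2)) ≤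
      Real.exp (a - ⟪b, m⟫_ℝ - c * ‖m‖ ^ 2 + ‖b + (2 * c) • m‖ ^ 2 * M ^ 2 / (2 * B)) := by
  have hn : 0 < n := hB1.trans hBn
  have hB' : (0 : ℝ) < B := by exact_mod_cast hB1
  set v := b + (2 * c) • m with hv
  set t : Fin n → ℝ := fun i => -((B : ℝ)⁻¹ * ⟪v, y i⟫_ℝ) with ht
  have htK : ∀ i, |t i| ≤ ‖v‖ * M / B := fun i => by
    rw [ht, abs_neg, abs_mul, abs_of_pos (inv_pos.mpr hB'), inv_mul_eq_div]
    gcongr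
    exact (abs_real_inner_le_norm _ _).trans (by gcongr; exact hy i)
  have hmean : (∑ i, t i) / n = -((B : ℝ)⁻¹ * ⟪v, m⟫_ℝ) := by
    rw [hm, real_inner_smul_right, inner_sum, ht, Finset.sum_neg_distrib, ← Finset.mul_sum]
    ring
  have hmgf : expectSubsets n B (fun I => Real.exp (∑ i ∈ I, t i)) ≤
      Real.exp (-⟪v, m⟫_ℝ + ‖v‖ ^ 2 * M ^ 2 / (2 * B)) := by
    refine (expectSubsets_exp_sum_le n B t hBn).trans
      ((pow_le_pow_left₀ (by positivity) (mean_exp_le hn t htK) B).trans (le_of_eq ?_))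
    rw [← Real.exp_nat_mul, hmean]
    congr 1
    field_simp
  have hpt (I : Finset (Fin n)) : Real.exp
      (a - ⟪b, (B : ℝ)⁻¹ • ∑ i ∈ I, y i⟫_ℝ - c * ‖(B : ℝ)⁻¹ • ∑ i ∈ I, y i‖ ^ 2) ≤
      Real.exp (a + c * ‖m‖ ^ 2) * Real.exp (∑ i ∈ I, t i) := by
    rw [← Real.exp_add, Real.exp_le_exp]
    set g := (B : ℝ)⁻¹ • ∑ i ∈ I, y i with hg
    have h1 : ∑ i ∈ I, t i = -⟪v, g⟫_ℝ := by
      rw [hg, real_inner_smul_right, inner_sum, ht, Finset.sum_neg_distrib, ← Finset.mul_sum]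
    have h2 := mul_nonneg hc (sq_nonneg ‖g - m‖)
    rw [norm_sub_sq_real, real_inner_comm] at h2
    rw [h1, hv, inner_add_left, real_inner_smul_left]
    linarith
  refine (expectSubsets_mono n B hpt).trans ?_
  rw [expectSubsets_const_mul]
  refine (mul_le_mul_of_nonneg_left hmgf (Real.exp_pos _).le).trans (le_of_eq ?_)
  rw [← Real.exp_add, hv, inner_add_left, real_inner_smul_left, real_inner_self_eq_norm_sq]
  congr 1
  ring

theorem statement18 {d n : ℕ} (hn : 0 < n)
    (fi : Fin n → EuclideanSpace ℝ (Fin d) → ℝ)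
    (f : EuclideanSpace ℝ (Fin d) → ℝ) (hf : f = fun x => (n : ℝ)⁻¹ * ∑ i, fi i x)
    (L G R βv η : ℝ)
    (hC1 : ∀ i, ContDiff ℝ 1 (fi i))
    (hLip : ∀ i, ∀ x y : EuclideanSpace ℝ (Fin d),
      ‖gradient (fi i) x - gradient (fi i) y‖ ≤ L * ‖x - y‖)
    (hG : G = Finset.sup' Finset.univ (Finset.univ_nonempty_iff.mpr ⟨⟨0, hn⟩⟩)
      (fun i => ‖gradient (fi i) (0 : EuclideanSpace ℝ (Fin d))‖))
    (hR : 0 < R) (hβ : 0 < βv) (hη : 0 < η)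
    (B : ℕ) (hB1 : 1 ≤ B) (hBn : B ≤ n)
    (M : ℝ) (hM : M = L * R + G)
    (u w : EuclideanSpace ℝ (Fin d)) (hu : ‖u‖ ≤ R) (hw : ‖w‖ ≤ R)
    (I1 I2 : ℝ)
    (hI1 : I1 = expectSubsets n B (fun I =>
      Real.exp (-βv * f w - βv * ‖u - w + η • stochGrad fi B w I‖ ^ 2 / (4 * η))))
    (hI2 : I2 = expectSubsets n B (fun I =>
      Real.exp (-βv * f u - βv * ‖w - u + η • stochGrad fi B u I‖ ^ 2 / (4 * η)))) :
    I1 / I2 ≥ Real.exp (-L * βv * ‖w - u‖ ^ 2 / 2 - βv * η * L * (L * R + G) * ‖w - u‖ / 2 -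
      βv ^ 2 * M ^ 2 * (‖w - u‖ ^ 2 + (L * R + G) ^ 2 * η ^ 2 + η * d / (2 * βv)) / (2 * B)) := by
  have hn' : (0 : ℝ) < n := by exact_mod_cast hn
  have hB' : (0 : ℝ) < B := by exact_mod_cast hB1
  have hGi (i : Fin n) : ‖gradient (fi i) 0‖ ≤ G := by
    rw [hG]
    exact Finset.le_sup' (fun i => ‖gradient (fi i) (0 : EuclideanSpace ℝ (Fin d))‖)
      (Finset.mem_univ i)
  rcases Nat.eq_zero_or_pos d with rfl | hd
  · obtain rfl : u = w := Subsingleton.elim _ _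
    rw [hI1, hI2, div_self]
    · rw [ge_iff_le, Real.exp_le_one_iff, sub_self, norm_zero]
      have : 0 ≤ βv ^ 2 * M ^ 2 * ((L * R + G) ^ 2 * η ^ 2) / (2 * B) := by positivity
      simpa using this
    · exact ((Real.exp_pos _).trans_le (exp_expectSubsets_le hBn _)).ne'
  have hL : 0 ≤ L := by
    have h := (norm_nonneg _).trans (hLip ⟨0, hn⟩ (EuclideanSpace.single ⟨0, hd⟩ 1) 0)
    simpa using h
  have hbound {x : EuclideanSpace ℝ (Fin d)} (hx : ‖x‖ ≤ R) (i : Fin n) :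
      ‖gradient (fi i) x‖ ≤ M := by
    have h1 := hLip i x 0
    rw [sub_zero] at h1
    have h2 := norm_le_norm_add_norm_sub' (gradient (fi i) x) (gradient (fi i) 0)
    have h3 := mul_le_mul_of_nonneg_left hx hL
    linarith [hGi i]
  have hM0 : 0 ≤ M := (norm_nonneg _).trans (hbound hu ⟨0, hn⟩)
  rw [← hM]
  set Δ := w - u with hΔ
  obtain ⟨mu, hmu⟩ : ∃ m, m = (n : ℝ)⁻¹ • ∑ i, gradient (fi i) u := ⟨_, rfl⟩
  obtain ⟨mw, hmw⟩ : ∃ m, m = (n : ℝ)⁻¹ • ∑ i, gradient (fi i) w := ⟨_, rfl⟩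
  have hmuM : ‖mu‖ ≤ M := hmu ▸ norm_mean_le hn (hbound hu)
  have hmwM : ‖mw‖ ≤ M := hmw ▸ norm_mean_le hn (hbound hw)
  have hmdiff : ‖mw - mu‖ ≤ L * ‖Δ‖ := by
    rw [hmw, hmu, ← smul_sub, ← Finset.sum_sub_distrib]
    exact norm_mean_le hn fun i => hLip i w u
  have htrap : f w - f u ≤ ⟪Δ, mw + mu⟫_ℝ / 2 + L / 2 * ‖Δ‖ ^ 2 := by
    have hs := Finset.sum_le_sum fun i (_ : i ∈ Finset.univ) =>
      sub_le_inner_gradient_add_of_lipschitz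
        (fun x => ((hC1 i).differentiable one_ne_zero x).hasGradientAt) (hLip i) u w
    rw [← hΔ, Finset.sum_add_distrib, Finset.sum_sub_distrib, ← Finset.sum_div, ← inner_sum,
      Finset.sum_add_distrib, Finset.sum_const, Finset.card_univ, Fintype.card_fin,
      nsmul_eq_mul] at hs
    have hs' := mul_le_mul_of_nonneg_left hs (inv_pos.mpr hn').le
    rw [hf, hmw, hmu, ← smul_add, real_inner_smul_right]
    refine le_trans (le_of_eq ?_) (hs'.trans (le_of_eq ?_))
    · ring
    · field_simp
  have hlow := exp_le_expectSubsets_exp hB1 hBn (hbound hw) hmw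
    (-βv * f w - βv / (4 * η) * ‖Δ‖ ^ 2) ((βv / 2) • Δ) (c := βv * η / 4) (by positivity)
  have hupp := expectSubsets_exp_le hB1 hBn (hbound hu) hmu
    (-βv * f u - βv / (4 * η) * ‖Δ‖ ^ 2) ((βv / 2) • Δ) (c := βv * η / 4) (by positivity)
  have hI1' : I1 = expectSubsets n B (fun I => Real.exp (-βv * f w - βv / (4 * η) * ‖Δ‖ ^ 2 +
      ⟪(βv / 2) • Δ, (B : ℝ)⁻¹ • ∑ i ∈ I, gradient (fi i) w⟫_ℝ -
      βv * η / 4 * ‖(B : ℝ)⁻¹ • ∑ i ∈ I, gradient (fi i) w‖ ^ 2)) := by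
    rw [hI1]
    congr 1
    funext I
    congr 1
    rw [← stochGrad, ← neg_sub w u, ← hΔ, norm_add_sq_real, norm_neg, inner_neg_left, norm_smul,
      real_inner_smul_left, real_inner_smul_right, Real.norm_of_nonneg hη.le]
    field_simp
    ring
  have hI2' : I2 = expectSubsets n B (fun I => Real.exp (-βv * f u - βv / (4 * η) * ‖Δ‖ ^ 2 -
      ⟪(βv / 2) • Δ, (B : ℝ)⁻¹ • ∑ i ∈ I, gradient (fi i) u⟫_ℝ -
      βv * η / 4 * ‖(B : ℝ)⁻¹ • ∑ i ∈ I, gradient (fi i) u‖ ^ 2)) := by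
    rw [hI2]
    congr 1
    funext I
    congr 1
    rw [← stochGrad, norm_add_sq_real, norm_smul,
      real_inner_smul_left, real_inner_smul_right, Real.norm_of_nonneg hη.le]
    field_simp
    ring
  rw [← hI1'] at hlow
  rw [← hI2'] at hupp
  have hI2pos : 0 < I2 := by
    rw [hI2]
    exact (Real.exp_pos _).trans_le (exp_expectSubsets_le hBn _)
  rw [ge_iff_le, le_div_iff₀ hI2pos]
  refine (mul_le_mul_of_nonneg_left hupp (Real.exp_pos _).le).trans (le_trans ?_ hlow)
  rw [← Real.exp_add, Real.exp_le_exp]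
  have hnorm : ‖(βv / 2) • Δ + (2 * (βv * η / 4)) • mu‖ ^ 2 ≤
      βv ^ 2 * (‖Δ‖ ^ 2 + M ^ 2 * η ^ 2) := by
    have h1 := norm_add_le ((βv / 2) • Δ) ((2 * (βv * η / 4)) • mu)
    rw [norm_smul, norm_smul, Real.norm_of_nonneg (by positivity),
      Real.norm_of_nonneg (by positivity)] at h1
    have h2 : 2 * (βv * η / 4) * ‖mu‖ ≤ 2 * (βv * η / 4) * M := by gcongr
    have h3 := pow_le_pow_left₀ (norm_nonneg _) (h1.trans (add_le_add_right h2 _)) 2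
    nlinarith [sq_nonneg (βv / 2 * ‖Δ‖ - 2 * (βv * η / 4) * M), sq_nonneg (βv * ‖Δ‖),
      sq_nonneg (βv * η * M)]
  have hsq : ‖mw‖ ^ 2 - ‖mu‖ ^ 2 ≤ 2 * M * (L * ‖Δ‖) := by
    have h1 : ‖mw‖ - ‖mu‖ ≤ L * ‖Δ‖ := (norm_sub_norm_le _ _).trans hmdiff
    have h2 : 0 ≤ L * ‖Δ‖ := by positivity
    nlinarith [norm_nonneg mw, norm_nonneg mu,
      mul_le_mul_of_nonneg_right h1 (add_nonneg (norm_nonneg mw) (norm_nonneg mu)),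
      mul_le_mul_of_nonneg_left (add_le_add hmwM hmuM) h2]
  have hd1 : (1 : ℝ) ≤ d := by exact_mod_cast hd
  have hfluct : ‖(βv / 2) • Δ + (2 * (βv * η / 4)) • mu‖ ^ 2 * M ^ 2 / (2 * B) +
      βv * η / 4 * (M ^ 2 / B) ≤
      βv ^ 2 * M ^ 2 * (‖Δ‖ ^ 2 + M ^ 2 * η ^ 2 + η * d / (2 * βv)) / (2 * B) := by
    have h1 : βv * η / 4 * (M ^ 2 / B) ≤ βv ^ 2 * M ^ 2 * (η * d / (2 * βv)) / (2 * B) := by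
      have h2 : βv ^ 2 * M ^ 2 * (η * d / (2 * βv)) / (2 * B) = βv * η / 4 * (M ^ 2 / B) * d := by
        field_simp
        ring
      rw [h2]
      exact le_mul_of_one_le_right (by positivity) hd1
    have h3 : ‖(βv / 2) • Δ + (2 * (βv * η / 4)) • mu‖ ^ 2 * M ^ 2 / (2 * B) ≤
        βv ^ 2 * (‖Δ‖ ^ 2 + M ^ 2 * η ^ 2) * M ^ 2 / (2 * B) := by gcongr
    refine (add_le_add h3 h1).trans (le_of_eq ?_)
    ring
  rw [inner_add_right] at htrap
  rw [real_inner_smul_left, real_inner_smul_left]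
  have h1 := mul_le_mul_of_nonneg_left htrap hβ.le
  have h2 := mul_le_mul_of_nonneg_left hsq (by positivity : 0 ≤ βv * η / 4)
  linarith
end

section
/- Let m₁, m₂ ∈ ℝ^d and σ > 0. Then the total variation distance between the Gaussian measures N(m₁, σ² I_d) and N(m₂, σ² I_d) satisfies ‖N(m₁, σ² I_d) − N(m₂, σ² I_d)‖_TV ≤ ‖m₁ − m₂‖₂ / σ. -/
open MeasureTheory

/-- The Gaussian measure `N(μ, σ2 · I_d)` on `ℝ^d`, defined via its density with
respect to the Lebesgue measure. -/
noncomputable def gaussMeasure {d : ℕ} (μ : EuclideanSpace ℝ (Fin d)) (σ2 : ℝ) :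
    Measure (EuclideanSpace ℝ (Fin d)) :=
  volume.withDensity fun x =>
    ENNReal.ofReal ((2 * Real.pi * σ2) ^ (-(d : ℝ) / 2) * Real.exp (-‖x - μ‖ ^ 2 / (2 * σ2)))

/-- The density of `gaussMeasure μ (σ ^ 2)` with respect to the Lebesgue measure. -/
noncomputable def gaussDensity {d : ℕ} (μ : EuclideanSpace ℝ (Fin d)) (σ : ℝ)
    (x : EuclideanSpace ℝ (Fin d)) : ℝ :=
  (2 * Real.pi * σ ^ 2) ^ (-(d : ℝ) / 2) * Real.exp (-‖x - μ‖ ^ 2 / (2 * σ ^ 2))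

lemma gaussDensity_nonneg {d : ℕ} (μ : EuclideanSpace ℝ (Fin d)) (σ : ℝ)
    (x : EuclideanSpace ℝ (Fin d)) : 0 ≤ gaussDensity μ σ x := by
  have := Real.pi_pos
  unfold gaussDensity
  positivity

lemma integral_gaussDensity {d : ℕ} (μ : EuclideanSpace ℝ (Fin d)) {σ : ℝ} (hσ : 0 < σ) :
    ∫ x, gaussDensity μ σ x = 1 := by
  have hπ := Real.pi_pos
  have h := GaussianFourier.integral_rexp_neg_mul_sq_norm (V := EuclideanSpace ℝ (Fin d))
    (b := 1 / (2 * σ ^ 2)) (by positivity)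
  rw [finrank_euclideanSpace_fin] at h
  unfold gaussDensity
  rw [integral_const_mul,
    integral_sub_right_eq_self (fun x : EuclideanSpace ℝ (Fin d) ↦
      Real.exp (-‖x‖ ^ 2 / (2 * σ ^ 2))) μ]
  have he : (fun x : EuclideanSpace ℝ (Fin d) ↦ Real.exp (-‖x‖ ^ 2 / (2 * σ ^ 2))) =
      fun x ↦ Real.exp (-(1 / (2 * σ ^ 2)) * ‖x‖ ^ 2) := by
    funext x
    congr 1
    ring
  have hb : Real.pi / (1 / (2 * σ ^ 2)) = 2 * Real.pi * σ ^ 2 := by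
    field_simp
  rw [he, h, hb, ← Real.rpow_add (by positivity), neg_div, neg_add_cancel, Real.rpow_zero]

lemma integrable_gaussDensity {d : ℕ} (μ : EuclideanSpace ℝ (Fin d)) {σ : ℝ} (hσ : 0 < σ) :
    Integrable (gaussDensity μ σ) :=
  .of_integral_ne_zero (by simp [integral_gaussDensity μ hσ])

lemma toReal_gaussMeasure {d : ℕ} (μ : EuclideanSpace ℝ (Fin d)) {σ : ℝ} (hσ : 0 < σ)
    {A : Set (EuclideanSpace ℝ (Fin d))} (hA : MeasurableSet A) :
    (gaussMeasure μ (σ ^ 2) A).toReal = ∫ x in A, gaussDensity μ σ x := by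
  rw [gaussMeasure, withDensity_apply _ hA, integral_eq_lintegral_of_nonneg_ae
    (.of_forall (gaussDensity_nonneg μ σ)) (integrable_gaussDensity μ hσ).integrableOn.1]
  rfl

/-- The geometric mean of two Gaussian densities is a multiple of the Gaussian density centred at
the midpoint. -/
lemma gaussDensity_mul_gaussDensity {d : ℕ} (m1 m2 : EuclideanSpace ℝ (Fin d)) (σ : ℝ)
    (x : EuclideanSpace ℝ (Fin d)) :
    gaussDensity m1 σ x * gaussDensity m2 σ x =
      (Real.exp (-(‖m1 - m2‖ / σ) ^ 2 / 8) * gaussDensity (midpoint ℝ m1 m2) σ x) ^ 2 := by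
  have hpar : ‖x - m1‖ ^ 2 + ‖x - m2‖ ^ 2 =
      2 * ‖x - midpoint ℝ m1 m2‖ ^ 2 + ‖m1 - m2‖ ^ 2 / 2 := by
    have h := parallelogram_law_with_norm ℝ (x - m1) (x - m2)
    have h1 : x - m1 + (x - m2) = (2 : ℝ) • (x - midpoint ℝ m1 m2) := by
      rw [midpoint_eq_smul_add, smul_sub, smul_smul]
      norm_num
      rw [two_smul]
      abel
    rw [h1, sub_sub_sub_cancel_left, norm_smul, norm_sub_rev m2 m1] at h
    norm_num at h
    linarith
  unfold gaussDensity
  generalize (2 * Real.pi * σ ^ 2) ^ (-(d : ℝ) / 2) = c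
  rw [mul_pow, mul_pow, ← Real.exp_nat_mul, ← Real.exp_nat_mul, mul_mul_mul_comm, ← Real.exp_add,
    mul_left_comm, ← Real.exp_add, sq c]
  congr 2
  rw [← add_div, ← neg_add, hpar]
  push_cast
  ring

lemma abs_sub_le_of_mul_eq_sq {p q r t : ℝ} (hp : 0 ≤ p) (hq : 0 ≤ q) (hr : 0 ≤ r)
    (ht : 0 < t) (h : p * q = r ^ 2) :
    |p - q| ≤ t / 2 * (p + q - 2 * r) + 1 / (2 * t) * (p + q + 2 * r) := by
  have hrle : 2 * r ≤ p + q := (abs_le_of_sq_le_sq' (by nlinarith [sq_nonneg (p - q)])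
    (by positivity)).2
  have hgap : 0 ≤ p + q - 2 * r := by linarith
  refine abs_le_of_sq_le_sq ?_ (by positivity)
  have hprod : (p - q) ^ 2 =
      4 * (t / 2 * (p + q - 2 * r)) * (1 / (2 * t) * (p + q + 2 * r)) := by
    field_simp
    linear_combination -16 * h
  rw [hprod]
  exact four_mul_le_sq_add _ _

theorem statement19 {d : ℕ} (m1 m2 : EuclideanSpace ℝ (Fin d)) (σ : ℝ) (hσ : 0 < σ) :
    ∀ A : Set (EuclideanSpace ℝ (Fin d)), MeasurableSet A →
      |(gaussMeasure m1 (σ ^ 2) A).toReal - (gaussMeasure m2 (σ ^ 2) A).toReal| ≤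
        ‖m1 - m2‖ / σ := by
  intro A hA
  rcases eq_or_ne m1 m2 with rfl | hne
  · simp
  set D := ‖m1 - m2‖ / σ
  have hDpos : 0 < D := div_pos (norm_pos_iff.2 (sub_ne_zero.2 hne)) hσ
  set E := Real.exp (-D ^ 2 / 8)
  have hE1 : E ≤ 1 := Real.exp_le_one_iff.2 (by nlinarith)
  have hE2 : 1 - D ^ 2 / 8 ≤ E := by
    linarith [Real.add_one_le_exp (-D ^ 2 / 8)]
  have h1 := integrable_gaussDensity m1 hσ
  have h2 := integrable_gaussDensity m2 hσ
  have h3 := (integrable_gaussDensity (midpoint ℝ m1 m2) hσ).const_mul (2 * E)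
  rw [toReal_gaussMeasure m1 hσ hA, toReal_gaussMeasure m2 hσ hA,
    ← integral_sub h1.integrableOn h2.integrableOn]
  have hI1 := ((h1.add h2).sub h3).const_mul (4 / D / 2)
  have hI2 := ((h1.add h2).add h3).const_mul (1 / (2 * (4 / D)))
  calc _ ≤ ∫ x in A, |gaussDensity m1 σ x - gaussDensity m2 σ x| := abs_integral_le_integral_abs
    _ ≤ ∫ x, |gaussDensity m1 σ x - gaussDensity m2 σ x| :=
      setIntegral_le_integral (h1.sub h2).abs (.of_forall fun _ ↦ abs_nonneg _)
    _ ≤ _ := integral_mono (h1.sub h2).abs (hI1.add hI2) fun x ↦ by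
      simpa [mul_assoc] using
        abs_sub_le_of_mul_eq_sq (t := 4 / D) (gaussDensity_nonneg m1 σ x)
        (gaussDensity_nonneg m2 σ x)
        (mul_nonneg (Real.exp_pos _).le (gaussDensity_nonneg _ σ x)) (by positivity)
        (gaussDensity_mul_gaussDensity m1 m2 σ x)
    _ = 4 / D * (1 - E) + D / 4 * (1 + E) := by
      rw [integral_add' hI1 hI2, integral_const_mul, integral_const_mul,
        integral_sub' (h1.add h2) h3, integral_add' (h1.add h2) h3, integral_add' h1 h2,
        integral_const_mul, integral_gaussDensity m1 hσ, integral_gaussDensity m2 hσ,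
        integral_gaussDensity _ hσ]
      field_simp
      ring
    _ ≤ 4 / D * (D ^ 2 / 8) + D / 4 * 2 := by gcongr <;> linarith
    _ = D := by
      field_simp
      ring
end
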